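/- Let A be a nondegenerate dendrite, i.e., a compact connected locally connected metric space containing more than one point and containing no subspace homeomorphic to the circle S¹. Then the set of points x ∈ A such that A \ {x} has exactly two connected components is uncountable. In particular, for every countable subset U ⊆ A there exists such a cutpoint x of order 2 with x ∉ U. -/

import Mathlib

/-- `x` is a cutpoint of order 2 of `A`: the complement `A \ {x}` has exactly two
connected components. -/
def IsOrderTwoCutpoint {A : Type*} [TopologicalSpace A] (x : A) : Prop :=
  ∃ S T : Set A, S ≠ T ∧
    {Z : Set A | ∃ y : A, y ≠ x ∧ Z = connectedComponentIn {x}ᶜ y} = {S, T}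

open Set Filter Topology unitInterval

/-- `f` varies finely on `[a, b]`: nearby parameters are sent into a common connected open
set all of whose points are within distance `ε` of each other. -/
def FineOn {X : Type*} [PseudoMetricSpace X] (ε : ℝ) (f : ℝ → X) (a b : ℝ) : Prop :=
  ∀ x ∈ Icc a b, ∀ᶠ y in 𝓝[Icc a b] x, ∃ V : Set X, IsOpen V ∧ IsPreconnected V ∧
    f x ∈ V ∧ f y ∈ V ∧ ∀ u ∈ V, ∀ v ∈ V, dist u v ≤ ε

section LocallyConnected

variable {X : Type*} [PseudoMetricSpace X]

theorem FineOn.glue {ε : ℝ} {f g : ℝ → X} {a b c : ℝ} (hf : FineOn ε f a b) (hg : FineOn ε g b c)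
    (hfg : f b = g b) : FineOn ε (fun x => if x ≤ b then f x else g x) a c := by
  intro x hx
  rw [eventually_nhdsWithin_iff]
  rcases lt_trichotomy x b with hxb | rfl | hxb
  · have h := eventually_nhdsWithin_iff.1 (hf x ⟨hx.1, hxb.le⟩)
    filter_upwards [h, eventually_lt_nhds hxb] with y hy hyb hyc
    simpa [hxb.le, hyb.le] using hy ⟨hyc.1, hyb.le⟩
  · have h := eventually_nhdsWithin_iff.1 (hf x ⟨hx.1, le_rfl⟩)
    have h' := eventually_nhdsWithin_iff.1 (hg x ⟨le_rfl, hx.2⟩)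
    filter_upwards [h, h'] with y hy hy' hyc
    rcases le_or_gt y x with hyx | hyx
    · simpa [hyx] using hy ⟨hyc.1, hyx⟩
    · simpa [hyx.not_ge, hfg] using hy' ⟨hyx.le, hyc.2⟩
  · have h := eventually_nhdsWithin_iff.1 (hg x ⟨hxb.le, hx.2⟩)
    filter_upwards [h, eventually_gt_nhds hxb] with y hy hyb hyc
    simpa [hxb.not_ge, hyb.not_ge] using hy ⟨hyb.le, hyc.2⟩

variable [LocallyConnectedSpace X]

theorem exists_isPreconnected_dist_le {ε : ℝ} (hε : 0 < ε) {U : Set X} (hU : IsOpen U) {x : X}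
    (hx : x ∈ U) : ∃ V : Set X, V ⊆ U ∧ IsOpen V ∧ x ∈ V ∧ IsPreconnected V ∧
      ∀ u ∈ V, ∀ v ∈ V, dist u v ≤ ε := by
  obtain ⟨V, hVU, hVo, hxV, hVc⟩ := locallyConnectedSpace_iff_subsets_isOpen_isConnected.1
    inferInstance x (U ∩ Metric.ball x (ε / 2))
    (inter_mem (hU.mem_nhds hx) (Metric.ball_mem_nhds x (half_pos hε)))
  refine ⟨V, hVU.trans inter_subset_left, hVo, hxV, hVc.isPreconnected, fun u hu v hv => ?_⟩
  have h1 := Metric.mem_ball.1 (hVU hu).2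
  have h2 := Metric.mem_ball.1 (hVU hv).2
  linarith [dist_triangle_right u v x]

theorem IsPreconnected.exists_fineOn {C : Set X} (hC : IsPreconnected C) (hCo : IsOpen C)
    {ε : ℝ} (hε : 0 < ε) {x y : X} (hx : x ∈ C) (hy : y ∈ C) {a b : ℝ} (hab : a < b) :
    ∃ f : ℝ → X, FineOn ε f a b ∧ f a = x ∧ f b = y ∧ ∀ t ∈ Icc a b, f t ∈ C := by
  revert a b
  refine hC.induction₂' (fun x y => ∀ {a b : ℝ}, a < b →
    ∃ f : ℝ → X, FineOn ε f a b ∧ f a = x ∧ f b = y ∧ ∀ t ∈ Icc a b, f t ∈ C) ?_ ?_ hx hy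
  · intro x hx
    obtain ⟨V, hVC, hVo, hxV, hVc, hV⟩ := exists_isPreconnected_dist_le hε hCo hx
    have key : ∀ u ∈ V, ∀ v ∈ V, ∀ {a b : ℝ}, a < b →
        ∃ f : ℝ → X, FineOn ε f a b ∧ f a = u ∧ f b = v ∧ ∀ t ∈ Icc a b, f t ∈ C := by
      intro u hu v hv a b hab
      have hmem : ∀ t, (if t < b then u else v) ∈ V := fun t => by split_ifs <;> assumption
      exact ⟨fun t => if t < b then u else v,
        fun x _ => .of_forall fun y => ⟨V, hVo, hVc, hmem x, hmem y, hV⟩, by simp [hab], by simp,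
        fun t _ => hVC (hmem t)⟩
    filter_upwards [mem_nhdsWithin_of_mem_nhds (hVo.mem_nhds hxV)] with y hyV
    exact ⟨key x hxV y hyV, key y hyV x hxV⟩
  · intro x y z _ _ _ hxy hyz a b hab
    obtain ⟨f, hf, hfa, hfb, hfC⟩ := hxy (left_lt_add_div_two.2 hab)
    obtain ⟨g, hg, hga, hgb, hgC⟩ := hyz (add_div_two_lt_right.2 hab)
    refine ⟨_, hf.glue hg (hfb.trans hga.symm), ?_, ?_, fun t ht => ?_⟩
    · simp [(left_lt_add_div_two.2 hab).le, hfa]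
    · simp [(add_div_two_lt_right.2 hab).not_ge, hgb]
    · split_ifs with h
      · exact hfC t ⟨ht.1, h⟩
      · exact hgC t ⟨(not_le.1 h).le, ht.2⟩

theorem FineOn.exists_refinement {ε δ : ℝ} (hδ : 0 < δ) {f : ℝ → X} (hf : FineOn ε f 0 1) :
    ∃ g : ℝ → X, FineOn δ g 0 1 ∧ g 0 = f 0 ∧ g 1 = f 1 ∧
      ∀ t ∈ Icc (0 : ℝ) 1, dist (f t) (g t) ≤ 2 * ε := by
  let c : I → Set I := fun x => interior {y | ∃ V : Set X, IsOpen V ∧ IsPreconnected V ∧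
    f x ∈ V ∧ f y ∈ V ∧ ∀ u ∈ V, ∀ v ∈ V, dist u v ≤ ε}
  have hc : ∀ x, x ∈ c x := fun x => by
    have := hf x x.2
    rw [nhdsWithin_eq_map_subtype_coe x.2] at this
    exact mem_interior_iff_mem_nhds.2 this
  obtain ⟨t, ht0, htm, ⟨N, hN⟩, ht⟩ := exists_monotone_Icc_subset_open_cover_unitInterval
    (c := c) (fun _ => isOpen_interior) fun x _ => mem_iUnion.2 ⟨x, hc x⟩
  suffices ∀ n, ∃ g : ℝ → X, FineOn δ g 0 (t n) ∧ g 0 = f 0 ∧ g (t n) = f (t n) ∧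
      ∀ s ∈ Icc (0 : ℝ) (t n), dist (f s) (g s) ≤ 2 * ε by
    simpa [hN N le_rfl] using this N
  intro n
  induction n with
  | zero =>
    obtain ⟨V, -, hVo, hxV, hVc, hV⟩ := exists_isPreconnected_dist_le hδ isOpen_univ
      (mem_univ (f 0))
    obtain ⟨W, -, -, h0, -, hW⟩ := (hf 0 (by simp)).self_of_nhdsWithin (by simp)
    have hε : 0 ≤ ε := dist_nonneg.trans (hW _ h0 _ h0)
    refine ⟨fun _ => f 0, fun x _ => .of_forall fun y => ⟨V, hVo, hVc, hxV, hxV, hV⟩, rfl,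
      by simp [ht0], fun s hs => ?_⟩
    have : s = 0 := by simpa [ht0] using hs
    simp [this, hε]
  | succ n ih =>
    obtain ⟨g, hg, hg0, hgt, hgf⟩ := ih
    rcases (htm n.le_succ).eq_or_lt with heq | hlt
    · rw [← Nat.succ_eq_add_one, ← heq]
      exact ⟨g, hg, hg0, hgt, hgf⟩
    have hlt' : (t n : ℝ) < t (n + 1) := hlt
    obtain ⟨x, hx⟩ := ht n
    have hcov : ∀ s ∈ Icc (t n) (t (n + 1)), _ := fun s hs => interior_subset (hx hs)
    obtain ⟨V, hVo, hVc, hxV, hV1, hV⟩ := hcov (t n) (left_mem_Icc.2 hlt.le)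
    obtain ⟨W, hWo, hWc, hxW, hW1, hW⟩ := hcov (t (n + 1)) (right_mem_Icc.2 hlt.le)
    obtain ⟨k, hk, hk0, hk1, hkC⟩ := (hVc.union _ hxV hxW hWc).exists_fineOn (hVo.union hWo) hδ
      (Or.inl hV1) (Or.inr hW1) hlt'
    refine ⟨_, hg.glue hk (hgt.trans hk0.symm), ?_, ?_, fun s hs => ?_⟩
    · simp [(t n).2.1, hg0]
    · simp [hlt'.not_ge, hk1]
    · split_ifs with h
      · exact hgf s ⟨hs.1, h⟩
      · have hs1 : s ≤ 1 := hs.2.trans (t (n + 1)).2.2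
        obtain ⟨Z, -, -, hxZ, hsZ, hZ⟩ := hcov ⟨s, hs.1, hs1⟩ ⟨(not_le.1 h).le, hs.2⟩
        have h1 : dist (f s) (f x) ≤ ε := hZ _ hsZ _ hxZ
        have h2 : dist (f x) (k s) ≤ ε := by
          rcases hkC s ⟨(not_le.1 h).le, hs.2⟩ with h | h
          · exact hV _ hxV _ h
          · exact hW _ hxW _ h
        linarith [dist_triangle (f s) (f x) (k s)]

/-- The limit of successive refinements is a path. -/
theorem FineOn.exists_path [CompleteSpace X] {ε : ℝ} (hε : 0 < ε) {f : ℝ → X}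
    (hf : FineOn ε f 0 1) :
    ∃ γ : Path (f 0) (f 1), ∀ t : I, dist (f t) (γ t) ≤ 4 * ε := by
  let S : ℕ → Type _ := fun n => {g : ℝ → X // FineOn (ε * (1 / 2) ^ n) g 0 1}
  have step : ∀ n (g : S n), ∃ h : S (n + 1), h.1 0 = g.1 0 ∧ h.1 1 = g.1 1 ∧
      ∀ t ∈ Icc (0 : ℝ) 1, dist (g.1 t) (h.1 t) ≤ 2 * (ε * (1 / 2) ^ n) := by
    intro n g
    obtain ⟨h, h1, h2⟩ := g.2.exists_refinement (δ := ε * (1 / 2) ^ (n + 1)) (by positivity)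
    exact ⟨⟨h, h1⟩, h2⟩
  choose next hnext0 hnext1 hnext using step
  let F : ∀ n, S n := fun n => Nat.rec ⟨f, by simpa using hf⟩ next n
  have hF0 : ∀ n, (F n).1 0 = f 0 := fun n => by
    induction n with
    | zero => rfl
    | succ n ih => exact (hnext0 n (F n)).trans ih
  have hF1 : ∀ n, (F n).1 1 = f 1 := fun n => by
    induction n with
    | zero => rfl
    | succ n ih => exact (hnext1 n (F n)).trans ih
  have hd : ∀ t : I, ∀ n, dist ((F n).1 t) ((F (n + 1)).1 t) ≤ 2 * ε * (1 / 2) ^ n := by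
    intro t n
    have := hnext n (F n) t t.2
    rwa [← mul_assoc] at this
  have hlim : ∀ t : I, ∃ y, (t = 0 → y = f 0) ∧ (t = 1 → y = f 1) ∧
      ∀ n, dist ((F n).1 t) y ≤ 4 * ε * (1 / 2) ^ n := by
    intro t
    obtain ⟨y, hy⟩ := cauchySeq_tendsto_of_complete
      (cauchySeq_of_le_geometric _ _ one_half_lt_one (hd t))
    have hb : ∀ n, dist ((F n).1 t) y ≤ 4 * ε * (1 / 2) ^ n := fun n =>
      (dist_le_of_le_geometric_of_tendsto _ _ one_half_lt_one (hd t) hy n).trans_eq (by ring)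
    by_cases h0 : t = 0
    · subst h0
      exact ⟨f 0, fun _ => rfl, fun h => absurd h zero_ne_one, fun n => by
        rw [Icc.coe_zero, hF0, dist_self]; positivity⟩
    by_cases h1 : t = 1
    · subst h1
      exact ⟨f 1, fun h => absurd h one_ne_zero, fun _ => rfl, fun n => by
        rw [Icc.coe_one, hF1, dist_self]; positivity⟩
    exact ⟨y, fun h => absurd h h0, fun h => absurd h h1, hb⟩
  choose γ hγ0 hγ1 hγ using hlim
  refine ⟨⟨⟨γ, Metric.continuous_iff'.2 fun t e he => ?_⟩, hγ0 0 rfl, hγ1 1 rfl⟩, fun t => ?_⟩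
  · obtain ⟨n, hn⟩ := exists_pow_lt_of_lt_one (show 0 < e / (9 * ε) by positivity)
      (one_half_lt_one (α := ℝ))
    rw [lt_div_iff₀ (by positivity)] at hn
    have := (F n).2 t t.2
    rw [nhdsWithin_eq_map_subtype_coe t.2] at this
    filter_upwards [this] with s hs
    obtain ⟨V, -, -, htV, hsV, hV⟩ := hs
    have h1 := hV _ hsV _ htV
    have h2 := hγ t n
    have h3 := hγ s n
    have h4 := dist_triangle4 (γ s) ((F n).1 s) ((F n).1 t) (γ t)
    rw [dist_comm (γ s) ((F n).1 s)] at h4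
    linarith
  · have h := hγ t 0
    exact h.trans_eq (by ring)

theorem locallyPathConnectedSpace_of_completeSpace [CompleteSpace X] :
    LocallyPathConnectedSpace X := by
  rw [locallyPathConnectedSpace_iff_pathComponentIn_mem_nhds]
  intro x U hU hx
  obtain ⟨r, hr, hrU⟩ := Metric.isOpen_iff.1 hU x hx
  obtain ⟨V, -, hVo, hxV, hVc, hV⟩ := exists_isPreconnected_dist_le
    (show 0 < r / 6 by positivity) isOpen_univ (mem_univ x)
  filter_upwards [hVo.mem_nhds hxV] with y hy
  obtain ⟨f, hf, rfl, rfl, hfV⟩ := hVc.exists_fineOn hVo (show 0 < r / 6 by positivity) hxV hy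
    (zero_lt_one (α := ℝ))
  obtain ⟨γ, hγ⟩ := hf.exists_path (by positivity)
  refine ⟨γ, fun t => hrU ?_⟩
  have h1 := hγ t
  have h2 := hV _ (hfV t t.2) _ hxV
  have h3 := dist_triangle_left (γ t) (f 0) (f t)
  exact Metric.mem_ball.2 (by linarith)

end LocallyConnected

/-- A closed set of parameters in `[0, 1]`, containing the endpoints, across whose gaps `γ` takes
the same value. -/
structure IsPathSkeleton {X : Type*} (γ : ℝ → X) (K : Set ℝ) : Prop where
  isClosed : IsClosed K
  subset : K ⊆ Icc 0 1
  zero_mem : 0 ∈ K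
  one_mem : 1 ∈ K
  gap : ∀ a ∈ K, ∀ b ∈ K, a < b → Disjoint (Ioo a b) K → γ a = γ b

namespace IsPathSkeleton

variable {X : Type*} {γ : ℝ → X} {K : Set ℝ}

theorem exists_isGreatest (hK : IsPathSkeleton γ K) {t : ℝ} (ht : t ∈ Icc (0 : ℝ) 1) :
    ∃ m, IsGreatest (K ∩ Iic t) m :=
  ((isCompact_Icc.of_isClosed_subset hK.isClosed hK.subset).inter_right isClosed_Iic).exists_isGreatest
    ⟨0, hK.zero_mem, ht.1⟩

theorem exists_isLeast (hK : IsPathSkeleton γ K) {t : ℝ} (ht : t ∈ Icc (0 : ℝ) 1) :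
    ∃ m, IsLeast (K ∩ Ici t) m :=
  ((isCompact_Icc.of_isClosed_subset hK.isClosed hK.subset).inter_right isClosed_Ici).exists_isLeast
    ⟨1, hK.one_mem, ht.2⟩

theorem apply_eq (hK : IsPathSkeleton γ K) {t m M : ℝ} (hm : IsGreatest (K ∩ Iic t) m)
    (hM : IsLeast (K ∩ Ici t) M) : γ m = γ M := by
  have hmt : m ≤ t := hm.1.2
  have htM : t ≤ M := hM.1.2
  rcases (hmt.trans htM).eq_or_lt with rfl | hlt
  · rfl
  refine hK.gap m hm.1.1 M hM.1.1 hlt (disjoint_left.2 fun x hx hxK => ?_)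
  rcases le_total x t with h | h
  · exact hx.1.not_ge (hm.2 ⟨hxK, h⟩)
  · exact hx.2.not_ge (hM.2 ⟨hxK, h⟩)

theorem sInter [TopologicalSpace X] [T2Space X] (hγ : Continuous γ) {c : Set (Set ℝ)}
    (hc : ∀ K ∈ c, IsPathSkeleton γ K) (hchain : IsChain (· ⊆ ·) c) (hne : c.Nonempty) :
    IsPathSkeleton γ (⋂₀ c) where
  isClosed := isClosed_sInter fun K hK => (hc K hK).isClosed
  subset := by
    obtain ⟨K, hK⟩ := hne
    exact (sInter_subset_of_mem hK).trans (hc K hK).subset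
  zero_mem := fun K hK => (hc K hK).zero_mem
  one_mem := fun K hK => (hc K hK).one_mem
  gap := by
    intro a ha b hb hab hdis
    by_contra hne'
    obtain ⟨U, V, hU, hV, haU, hbV, hUV⟩ := t2_separation hne'
    obtain ⟨a', ha', hUa⟩ := (mem_nhdsGE_iff_exists_mem_Ioc_Ico_subset
      (left_lt_add_div_two.2 hab)).1
      (mem_nhdsWithin_of_mem_nhds ((hU.preimage hγ).mem_nhds haU))
    obtain ⟨b', hb', hVb⟩ := (mem_nhdsLE_iff_exists_mem_Ico_Ioc_subset
      (add_div_two_lt_right.2 hab)).1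
      (mem_nhdsWithin_of_mem_nhds ((hV.preimage hγ).mem_nhds hbV))
    have : Nonempty c := hne.to_subtype
    obtain ⟨⟨K, hKc⟩, hK⟩ := (isCompact_Icc (a := a') (b := b')).elim_directed_family_closed
      (fun K : c => (K : Set ℝ)) (fun K => (hc K K.2).isClosed)
      (by
        rw [← sInter_eq_iInter, ← disjoint_iff_inter_eq_empty]
        exact hdis.mono_left (Icc_subset_Ioo ha'.1 hb'.2))
      (fun K L => (hchain.total K.2 L.2).elim (fun h => ⟨K, subset_rfl, h⟩)
        fun h => ⟨L, h, subset_rfl⟩)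
    have hmid : (a + b) / 2 ∈ Icc (0 : ℝ) 1 := by
      have h1 := ((hc K hKc).subset (ha K hKc)).1
      have h2 := ((hc K hKc).subset (hb K hKc)).2
      constructor <;> linarith
    obtain ⟨m, hm⟩ := (hc K hKc).exists_isGreatest hmid
    obtain ⟨M, hM⟩ := (hc K hKc).exists_isLeast hmid
    have hmK : m ∉ Icc a' b' := fun h => (hK.subset ⟨h, hm.1.1⟩ : m ∈ (∅ : Set ℝ))
    have hMK : M ∉ Icc a' b' := fun h => (hK.subset ⟨h, hM.1.1⟩ : M ∈ (∅ : Set ℝ))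
    have ham : a ≤ m := hm.2 ⟨ha K hKc, by simpa using (left_lt_add_div_two.2 hab).le⟩
    have hMb : M ≤ b := hM.2 ⟨hb K hKc, by simpa using (add_div_two_lt_right.2 hab).le⟩
    have hma' : m < a' := not_le.1 fun h => hmK ⟨h, (show m ≤ _ from hm.1.2).trans hb'.1⟩
    have hMb' : b' < M := not_le.1 fun h => hMK ⟨ha'.2.trans (show _ ≤ M from hM.1.2), h⟩
    have hmU : γ m ∈ U := hUa ⟨ham, hma'⟩
    have hMV : γ M ∈ V := hVb ⟨hMb', hMb⟩
    exact disjoint_left.1 hUV hmU ((hc K hKc).apply_eq hm hM ▸ hMV)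

theorem sdiff_Ioo (hK : IsPathSkeleton γ K) {a b : ℝ} (ha : a ∈ K) (hb : b ∈ K)
    (hab : γ a = γ b) : IsPathSkeleton γ (K \ Ioo a b) where
  isClosed := hK.isClosed.sdiff isOpen_Ioo
  subset := sdiff_subset.trans hK.subset
  zero_mem := ⟨hK.zero_mem, fun h => h.1.not_ge (hK.subset ha).1⟩
  one_mem := ⟨hK.one_mem, fun h => h.2.not_ge (hK.subset hb).2⟩
  gap := by
    intro c hc d hd hcd hdis
    by_cases h : Disjoint (Ioo c d) K
    · exact hK.gap c hc.1 d hd.1 hcd h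
    obtain ⟨x, hx, hxK⟩ := not_disjoint_iff.1 h
    have hxab : x ∈ Ioo a b := by_contra fun hn => disjoint_left.1 hdis hx ⟨hxK, hn⟩
    have hca : c ≤ a := not_lt.1 fun h => hc.2 ⟨h, hx.1.trans hxab.2⟩
    have hbd : b ≤ d := not_lt.1 fun h => hd.2 ⟨hxab.1.trans hx.2, h⟩
    have hac : a ≤ c := not_lt.1 fun h =>
      disjoint_left.1 hdis ⟨h, hxab.1.trans hx.2⟩ ⟨ha, fun h => h.1.false⟩
    have hdb : d ≤ b := not_lt.1 fun h =>
      disjoint_left.1 hdis ⟨hx.1.trans hxab.2, h⟩ ⟨hb, fun h => h.2.false⟩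
    rw [hca.antisymm hac, hdb.antisymm hbd, hab]

end IsPathSkeleton

theorem Continuous.exists_minimal_isPathSkeleton {X : Type*} [TopologicalSpace X] [T2Space X]
    {γ : ℝ → X} (hγ : Continuous γ) : ∃ K, IsPathSkeleton γ K ∧
      ∀ a ∈ K, ∀ b ∈ K, γ a = γ b → Disjoint (Ioo a b) K := by
  obtain ⟨K, -, hK⟩ := zorn_superset_nonempty {K | IsPathSkeleton γ K}
    (fun c hc hchain hne => ⟨⋂₀ c, .sInter hγ hc hchain hne, fun s hs => sInter_subset_of_mem hs⟩)
    (Icc 0 1) ⟨isClosed_Icc, subset_rfl, by simp, by simp, fun a ha b hb hab hdis => by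
      obtain ⟨x, hx⟩ := nonempty_Ioo.2 hab
      exact (disjoint_left.1 hdis hx ⟨ha.1.trans hx.1.le, hx.2.le.trans hb.2⟩).elim⟩
  refine ⟨K, hK.prop, fun a ha b hb hab => disjoint_right.2 fun x hx => ?_⟩
  exact (hK.le_of_le (hK.prop.sdiff_Ioo ha hb hab) sdiff_subset hx).2

namespace Path

/-- A path can be shortcut to a path whose fibers are order-convex. -/
theorem exists_ordConnected_fibers {X : Type*} [TopologicalSpace X] [T2Space X] {p q : X}
    (γ : Path p q) : ∃ f : Path p q, range f ⊆ range γ ∧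
      ∀ s r t : I, s ≤ r → r ≤ t → f s = f t → f r = f s := by
  obtain ⟨K, hK, hmin⟩ := γ.continuous_extend.exists_minimal_isPathSkeleton
  choose m hm using fun t : I => hK.exists_isGreatest t.2
  choose M hM using fun t : I => hK.exists_isLeast t.2
  have hmt : ∀ t, m t ≤ t := fun t => (hm t).1.2
  have htM : ∀ t : I, (t : ℝ) ≤ M t := fun t => (hM t).1.2
  have hmK : ∀ t : I, (t : ℝ) ∈ K → m t = t := fun t ht =>
    (hmt t).antisymm ((hm t).2 ⟨ht, self_mem_Iic⟩)
  have hmM : ∀ t, γ.extend (m t) = γ.extend (M t) := fun t => hK.apply_eq (hm t) (hM t)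
  have hcont : Continuous fun t => γ.extend (m t) := by
    refine continuous_iff_continuousAt.2 fun t => ?_
    by_cases ht : (t : ℝ) ∈ K
    · intro W hW
      dsimp only at hW
      rw [hmK t ht] at hW
      have h1 := γ.continuous_extend.continuousAt hW
      obtain ⟨δ, hδ, hball⟩ := Metric.mem_nhds_iff.1 h1
      refine mem_map.2 ?_
      filter_upwards [Metric.ball_mem_nhds t hδ] with s hs
      have hs' : |(s : ℝ) - t| < δ := hs
      rw [abs_lt] at hs'
      rcases le_total t s with h | h
      · have h2 : (t : ℝ) ≤ m s := (hm s).2 ⟨ht, h⟩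
        refine hball (Metric.mem_ball.2 ?_)
        rw [Real.dist_eq, abs_lt]
        constructor <;> linarith [hmt s]
      · have h2 : M s ≤ t := (hM s).2 ⟨ht, h⟩
        change γ.extend (m s) ∈ W
        rw [hmM]
        refine hball (Metric.mem_ball.2 ?_)
        rw [Real.dist_eq, abs_lt]
        constructor <;> linarith [htM s]
    · have hev : ∀ᶠ s : I in 𝓝 t, m s = m t := by
        have h1 : m t < t := (hmt t).lt_of_ne fun h => ht (h ▸ (hm t).1.1)
        have h2 : (t : ℝ) < M t := (htM t).lt_of_ne fun h => ht (h ▸ (hM t).1.1)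
        filter_upwards [continuous_subtype_val.continuousAt (Ioo_mem_nhds h1 h2)] with s hs
        refine le_antisymm ((hm t).2 ⟨(hm s).1.1, mem_Iic.2 (not_lt.1 fun h => ?_)⟩)
          ((hm s).2 ⟨(hm t).1.1, hs.1.le⟩)
        exact ((hM t).2 ⟨(hm s).1.1, h.le⟩).not_gt ((hmt s).trans_lt hs.2)
      exact (continuousAt_const (y := γ.extend (m t))).congr (hev.mono fun s hs => by simp only [hs])
  refine ⟨⟨⟨_, hcont⟩, ?_, ?_⟩, ?_, ?_⟩
  · change γ.extend (m 0) = p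
    rw [hmK 0 hK.zero_mem]
    simp
  · change γ.extend (m 1) = q
    rw [hmK 1 hK.one_mem]
    simp
  · rintro _ ⟨t, rfl⟩
    rw [← γ.extend_range]
    exact mem_range_self _
  · intro s r t hsr hrt hst
    change γ.extend (m s) = γ.extend (m t) at hst
    change γ.extend (m r) = γ.extend (m s)
    have h1 : m s ≤ m r := (hm r).2 ⟨(hm s).1.1, (hmt s).trans hsr⟩
    have h2 : m r ≤ m t := (hm t).2 ⟨(hm r).1.1, (hmt r).trans hrt⟩
    rcases h1.eq_or_lt with h1 | h1
    · rw [h1]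
    rcases h2.eq_or_lt with h2 | h2
    · rw [h2, hst]
    exact (disjoint_left.1 (hmin _ (hm s).1.1 _ (hm t).1.1 hst) ⟨h1, h2⟩ (hm r).1.1).elim

section

variable {X : Type*} [MetricSpace X] {p q : X}

/-- The largest distance from `f a` reached by `f` between the parameters `a` and `t`. -/
noncomputable def excursion (f : Path p q) (a t : I) : ℝ :=
  sSup ((fun u : I => dist (f a) (f (a ⊔ (t ⊓ u)))) '' univ)

theorem continuous_excursion (f : Path p q) (a : I) : Continuous (f.excursion a) :=
  isCompact_univ.continuous_sSup (f := fun t u : I => dist (f a) (f (a ⊔ (t ⊓ u)))) <| by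
    unfold Function.HasUncurry.uncurry Function.hasUncurryInduction
    simp only [Function.HasUncurry.uncurry]
    fun_prop

theorem le_excursion (f : Path p q) (a t u : I) :
    dist (f a) (f (a ⊔ (t ⊓ u))) ≤ f.excursion a t :=
  le_csSup (isCompact_univ.image (by fun_prop)).bddAbove (mem_image_of_mem _ (mem_univ u))

theorem excursion_nonneg (f : Path p q) (a t : I) : 0 ≤ f.excursion a t :=
  dist_nonneg.trans (f.le_excursion a t 0)

theorem excursion_mono (f : Path p q) (a : I) : Monotone (f.excursion a) := by
  intro s t hst
  refine csSup_le (univ_nonempty.image _) ?_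
  rintro _ ⟨u, -, rfl⟩
  have := f.le_excursion a t (s ⊓ u)
  rwa [← inf_assoc, inf_eq_right.2 hst] at this

theorem excursion_of_le (f : Path p q) {a t : I} (h : t ≤ a) : f.excursion a t = 0 := by
  have : ∀ u, a ⊔ (t ⊓ u) = a := fun u => sup_eq_left.2 (inf_le_left.trans h)
  simp [excursion, this]

theorem excursion_congr (f : Path p q)
    (hf : ∀ s r t : I, s ≤ r → r ≤ t → f s = f t → f r = f s) (a : I) {s t : I} (hst : s ≤ t)
    (h : f s = f t) : f.excursion a s = f.excursion a t := by
  have key : ∀ u, f (a ⊔ (s ⊓ u)) = f (a ⊔ (t ⊓ u)) := by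
    intro u
    rcases le_total u s with hus | hsu
    · rw [inf_eq_right.2 hus, inf_eq_right.2 (hus.trans hst)]
    rcases le_total t a with hta | hat
    · rw [sup_eq_left.2 (inf_le_left.trans hta), sup_eq_left.2 (inf_le_left.trans (hst.trans hta))]
    rw [hf s (a ⊔ (s ⊓ u)) t _ _ h, hf s (a ⊔ (t ⊓ u)) t _ _ h]
    · exact (le_inf hst hsu).trans le_sup_right
    · exact sup_le hat inf_le_left
    · exact (le_inf le_rfl hsu).trans le_sup_right
    · exact sup_le hat (inf_le_left.trans hst)
  simp only [excursion, key]

/-- A continuous function on the parameters separating exactly the fibers of `f`. -/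
theorem exists_continuous_eq_iff (f : Path p q)
    (hf : ∀ s r t : I, s ≤ r → r ≤ t → f s = f t → f r = f s) :
    ∃ h : I → ℝ, Continuous h ∧ Monotone h ∧ ∀ s t, h s = h t ↔ f s = f t := by
  let d := TopologicalSpace.denseSeq I
  let g : ℕ → I → ℝ := fun n t => (1 / 2) ^ n * min 1 (f.excursion (d n) t)
  have hg0 : ∀ n t, 0 ≤ g n t := fun n t =>
    mul_nonneg (by positivity) (le_min zero_le_one (f.excursion_nonneg _ _))
  have hg1 : ∀ n t, g n t ≤ (1 / 2) ^ n := fun n t =>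
    mul_le_of_le_one_right (by positivity) (min_le_left _ _)
  have hgm : ∀ n, Monotone (g n) := fun n s t hst =>
    mul_le_mul_of_nonneg_left (min_le_min le_rfl (f.excursion_mono _ hst)) (by positivity)
  have hsum : ∀ t, Summable fun n => g n t := fun t =>
    summable_geometric_two.of_nonneg_of_le (fun n => hg0 n t) fun n => hg1 n t
  have hlt : ∀ s t, s < t → f s ≠ f t → ∑' n, g n s < ∑' n, g n t := by
    intro s t hst hne
    have hO : IsOpen (Ioo s t ∩ f ⁻¹' {f t}ᶜ) :=
      isOpen_Ioo.inter (isOpen_compl_singleton.preimage f.continuous)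
    have hOne : (Ioo s t ∩ f ⁻¹' {f t}ᶜ).Nonempty := by
      by_contra hemp
      rw [not_nonempty_iff_eq_empty] at hemp
      have hsub : closure (Ioo s t) ⊆ f ⁻¹' {f t} :=
        closure_minimal (fun x hx => by_contra fun hn => (hemp.subset ⟨hx, hn⟩ : x ∈ (∅ : Set I)))
          (isClosed_singleton.preimage f.continuous)
      rw [closure_Ioo hst.ne] at hsub
      exact hne (hsub (left_mem_Icc.2 hst.le))
    obtain ⟨_, ⟨hx, hxt⟩, n, rfl⟩ :=
      (TopologicalSpace.denseRange_denseSeq I).inter_open_nonempty _ hO hOne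
    refine (hsum s).tsum_lt_tsum (i := n) (fun k => hgm k hst.le) ?_ (hsum t)
    have h0 : g n s = 0 := by simp [g, d, f.excursion_of_le hx.1.le]
    rw [h0]
    refine mul_pos (by positivity) (lt_min zero_lt_one ((dist_pos.2 hxt).trans_le ?_))
    have := f.le_excursion (d n) t t
    rwa [inf_idem, sup_eq_right.2 hx.2.le] at this
  have heq : ∀ s t, s ≤ t → (∑' n, g n s = ∑' n, g n t ↔ f s = f t) := by
    refine fun s t hst => ⟨fun h => by_contra fun hne => ?_, fun h => ?_⟩
    · exact (hlt s t (hst.lt_of_ne fun h' => hne (h' ▸ rfl)) hne).ne h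
    · simp only [g, f.excursion_congr hf _ hst h]
  refine ⟨fun t => ∑' n, g n t, ?_, fun s t hst => ?_, fun s t => ?_⟩
  · refine continuous_tsum (fun n => ?_) summable_geometric_two fun n t => ?_
    · exact continuous_const.mul (continuous_const.min (f.continuous_excursion _))
    · rw [Real.norm_of_nonneg (hg0 n t)]
      exact hg1 n t
  · exact (hsum s).tsum_le_tsum (fun n => hgm n hst) (hsum t)
  · rcases le_total s t with h | h
    · exact heq s t h
    · rw [eq_comm, heq t s h, eq_comm]

theorem exists_injective (γ : Path p q) (hpq : p ≠ q) :
    ∃ α : Path p q, Function.Injective α ∧ range α ⊆ range γ := by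
  obtain ⟨f, hfγ, hf⟩ := γ.exists_ordConnected_fibers
  obtain ⟨h, hc, hm, hh⟩ := f.exists_continuous_eq_iff hf
  have h01 : h 0 < h 1 := (hm zero_le_one).lt_of_ne fun h01 => hpq (by simpa using (hh 0 1).1 h01)
  let H : I → I := fun t => ⟨(h t - h 0) / (h 1 - h 0),
    div_nonneg (sub_nonneg.2 (hm t.2.1)) (sub_pos.2 h01).le,
    (div_le_one (sub_pos.2 h01)).2 (sub_le_sub_right (hm t.2.2) _)⟩
  have hHc : Continuous H := by fun_prop
  have hH0 : H 0 = 0 := by simp [H]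
  have hH1 : H 1 = 1 := by simp [H, (sub_pos.2 h01).ne']
  have hHs : Function.Surjective H := fun u =>
    mem_range_of_exists_le_of_exists_ge hHc ⟨0, hH0.trans_le (show 0 ≤ u from u.2.1)⟩
      ⟨1, (show u ≤ 1 from u.2.2).trans_eq hH1.symm⟩
  have hH : ∀ s t, H s = H t ↔ f s = f t := fun s t => by
    rw [← hh, Subtype.ext_iff, div_left_inj' (sub_pos.2 h01).ne', sub_left_inj]
  have hHq : IsQuotientMap H := hHc.isClosedMap.isQuotientMap hHc hHs
  choose k hk using hHs
  have hfk : ∀ t, f (k (H t)) = f t := fun t => (hH _ _).1 (hk _)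
  have hcont : Continuous fun u => f (k u) :=
    hHq.continuous_iff.2 (f.continuous.congr fun t => (hfk t).symm)
  refine ⟨⟨⟨_, hcont⟩, ?_, ?_⟩, fun u v huv => ?_, ?_⟩
  · simpa [hH0] using hfk 0
  · simpa [hH1] using hfk 1
  · rw [← hk u, ← hk v]
    exact (hH _ _).2 huv
  · rintro _ ⟨u, rfl⟩
    exact hfγ (mem_range_self _)

end

end Path

namespace Path

theorem injective_subpath {X : Type*} [TopologicalSpace X] {p q : X} {α : Path p q}
    (hα : Function.Injective α) {a b : I} (hab : a ≠ b) : Function.Injective (α.subpath a b) := by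
  intro s t hst
  have h : (1 - (s : ℝ)) * a + s * b = (1 - (t : ℝ)) * a + t * b := congrArg Subtype.val (hα hst)
  have hab' : (b : ℝ) - a ≠ 0 := sub_ne_zero.2 fun h => hab (Subtype.ext h.symm)
  exact Subtype.ext (mul_right_cancel₀ hab' (by linear_combination h))

/-- Two arcs with common endpoints and no other common point form a circle. -/
theorem exists_homeomorph_addCircle {X : Type*} [TopologicalSpace X] [T2Space X] {p q : X}
    {α β : Path p q} (hα : Function.Injective α) (hβ : Function.Injective β)
    (h : range α ∩ range β ⊆ {p, q}) : ∃ s : Set X, Nonempty (s ≃ₜ AddCircle (1 : ℝ)) := by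
  have hα' : InjOn α.extend (Icc 0 1) := fun s hs t ht hst => by
    rw [α.extend_apply hs, α.extend_apply ht] at hst
    exact congrArg Subtype.val (hα hst)
  have hβ' : InjOn β.extend (Icc 0 1) := fun s hs t ht hst => by
    rw [β.extend_apply hs, β.extend_apply ht] at hst
    exact congrArg Subtype.val (hβ hst)
  have hαβ : ∀ s ∈ Icc (0 : ℝ) 1, ∀ t ∈ Ioo (0 : ℝ) 1, α.extend s ≠ β.extend t := by
    intro s hs t ht hst
    have hmem : β.extend t ∈ range α ∩ range β :=
      ⟨hst ▸ α.extend_range ▸ mem_range_self s, β.extend_range ▸ mem_range_self t⟩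
    rcases h hmem with h | h
    · exact ht.1.ne' (hβ' (Ioo_subset_Icc_self ht) (by simp) (h.trans β.extend_zero.symm))
    · exact ht.2.ne (hβ' (Ioo_subset_Icc_self ht) (by simp)
        ((mem_singleton_iff.1 h).trans β.extend_one.symm))
  let F : ℝ → X := fun t => if t ≤ 1 / 2 then α.extend (2 * t) else β.extend (2 - 2 * t)
  have hF : Continuous F :=
    Continuous.if_le (α.continuous_extend.comp (by fun_prop))
      (β.continuous_extend.comp (by fun_prop)) continuous_id continuous_const
      (by rintro x rfl; norm_num)
  have hF01 : F 0 = F 1 := by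
    have : ¬ (1 : ℝ) ≤ 1 / 2 := by norm_num
    simp only [F, if_neg this]
    norm_num
  have hinj : InjOn F (Ico 0 1) := by
    intro s hs t ht hst
    have hs' : ¬ s ≤ 1 / 2 → 2 - 2 * s ∈ Ioo (0 : ℝ) 1 := fun h =>
      ⟨by linarith [hs.2], by linarith⟩
    have ht' : ¬ t ≤ 1 / 2 → 2 - 2 * t ∈ Ioo (0 : ℝ) 1 := fun h =>
      ⟨by linarith [ht.2], by linarith⟩
    simp only [F] at hst
    split_ifs at hst with h1 h2 h2
    · linarith [hα' ⟨by linarith [hs.1], by linarith⟩ ⟨by linarith [ht.1], by linarith⟩ hst]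
    · exact (hαβ _ ⟨by linarith [hs.1], by linarith⟩ _ (ht' h2) hst).elim
    · exact (hαβ _ ⟨by linarith [ht.1], by linarith⟩ _ (hs' h1) hst.symm).elim
    · linarith [hβ' (Ioo_subset_Icc_self (hs' h1)) (Ioo_subset_Icc_self (ht' h2)) hst]
  have hc : Continuous (AddCircle.liftIco 1 0 F) :=
    AddCircle.liftIco_zero_continuous hF01 hF.continuousOn
  have hi : Function.Injective (AddCircle.liftIco 1 0 F) := by
    intro x y hxy
    obtain ⟨s, hs, rfl⟩ := AddCircle.coe_image_Ico_eq (1 : ℝ) 0 ▸ mem_univ x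
    obtain ⟨t, ht, rfl⟩ := AddCircle.coe_image_Ico_eq (1 : ℝ) 0 ▸ mem_univ y
    rw [AddCircle.liftIco_coe_apply hs, AddCircle.liftIco_coe_apply ht] at hxy
    rw [zero_add] at hs ht
    rw [hinj hs ht hxy]
  exact ⟨_, ⟨(hc.isClosedEmbedding hi).isEmbedding.toHomeomorph.symm⟩⟩

/-- In the absence of circles, two arcs with the same endpoints coincide. -/
theorem range_subset_range_of_injective {X : Type*} [TopologicalSpace X] [T2Space X] {p q : X}
    (hX : ∀ s : Set X, IsEmpty (s ≃ₜ AddCircle (1 : ℝ))) {α β : Path p q}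
    (hα : Function.Injective α) (hβ : Function.Injective β) : range α ⊆ range β := by
  rintro _ ⟨t, rfl⟩
  by_contra ht
  have hT : IsClosed (α ⁻¹' range β) := (isCompact_range β.continuous).isClosed.preimage α.continuous
  obtain ⟨a, ⟨⟨c, hc⟩, hat⟩, ha⟩ := (hT.inter isClosed_Iic).isCompact.exists_isGreatest
    (⟨0, ⟨0, by simp⟩, t.2.1⟩ : (α ⁻¹' range β ∩ Iic t).Nonempty)
  obtain ⟨b, ⟨⟨d, hd⟩, htb⟩, hb⟩ := (hT.inter isClosed_Ici).isCompact.exists_isLeast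
    (⟨1, ⟨1, by simp⟩, t.2.2⟩ : (α ⁻¹' range β ∩ Ici t).Nonempty)
  have hat' : a < t := lt_of_le_of_ne hat fun h => ht (h ▸ ⟨c, hc⟩)
  have htb' : t < b := lt_of_le_of_ne htb fun h => ht (h ▸ ⟨d, hd⟩)
  have hab : a < b := hat'.trans htb'
  have hcd : c ≠ d := fun h => hab.ne (hα (by rw [← hc, ← hd, h]))
  obtain ⟨s, ⟨e⟩⟩ := exists_homeomorph_addCircle (α := α.subpath a b)
    (β := (β.subpath c d).cast hc.symm hd.symm) (injective_subpath hα hab.ne)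
    (injective_subpath hβ hcd) <| by
      rintro x ⟨hxα, u, hu⟩
      rw [range_subpath_of_le _ _ _ hab.le] at hxα
      obtain ⟨r, hr, rfl⟩ := hxα
      have hrβ : r ∈ α ⁻¹' range β := ⟨_, hu⟩
      rcases le_total r t with h | h
      · exact Or.inl (congrArg α ((ha ⟨hrβ, h⟩).antisymm hr.1))
      · exact Or.inr (congrArg α (hr.2.antisymm (hb ⟨hrβ, h⟩)))
  exact (hX s).false e

/-- In a dendrite, removing a point of an arc does not leave its endpoints in a common component. -/
theorem target_notMem_connectedComponentIn {X : Type*} [MetricSpace X] [CompleteSpace X]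
    [LocallyConnectedSpace X] {p q : X} (hX : ∀ s : Set X, IsEmpty (s ≃ₜ AddCircle (1 : ℝ)))
    {α : Path p q} (hα : Function.Injective α) (t : I) :
    q ∉ connectedComponentIn {α t}ᶜ p := by
  have := locallyPathConnectedSpace_of_completeSpace (X := X)
  intro hq
  have hpt : p ∈ ({α t}ᶜ : Set X) := connectedComponentIn_nonempty_iff.1 ⟨q, hq⟩
  have hpq : p ≠ q := fun h => zero_ne_one (hα (by simpa using h) : (0 : I) = 1)
  obtain ⟨γ, hγ⟩ := (isOpen_compl_singleton.connectedComponentIn.isConnected_iff_isPathConnected.1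
    (isConnected_connectedComponentIn_iff.2 hpt)).joinedIn _ (mem_connectedComponentIn hpt) _ hq
  obtain ⟨β, hβ, hβγ⟩ := γ.exists_injective hpq
  obtain ⟨u, hu⟩ := hβγ (range_subset_range_of_injective hX hα hβ (mem_range_self t))
  exact connectedComponentIn_subset _ _ (hγ u) hu

end Path

section Components

variable {X : Type*} [TopologicalSpace X] [T1Space X] [LocallyConnectedSpace X]

theorem closure_connectedComponentIn_compl_singleton_subset (x y : X) :
    closure (connectedComponentIn {x}ᶜ y) ⊆ insert x (connectedComponentIn {x}ᶜ y) := by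
  intro z hz
  by_contra hn
  rw [mem_insert_iff, not_or] at hn
  have hzmem : z ∈ connectedComponentIn {x}ᶜ z := mem_connectedComponentIn hn.1
  obtain ⟨w, hwz, hwy⟩ := mem_closure_iff.1 hz _ isOpen_compl_singleton.connectedComponentIn hzmem
  rw [connectedComponentIn_eq hwz, ← connectedComponentIn_eq hwy] at hzmem
  exact hn.2 hzmem

/-- Components of the complements of two distinct points are disjoint as soon as neither contains
the other point. -/
theorem disjoint_connectedComponentIn_compl_singleton [PreconnectedSpace X] {x y a b : X}
    (hxy : x ≠ y) (hy : y ∉ connectedComponentIn {x}ᶜ a) (hx : x ∉ connectedComponentIn {y}ᶜ b) :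
    Disjoint (connectedComponentIn {x}ᶜ a) (connectedComponentIn {y}ᶜ b) := by
  refine disjoint_left.2 fun z hza hzb => ?_
  have h1 : connectedComponentIn {x}ᶜ a ⊆ connectedComponentIn {y}ᶜ b := by
    rw [connectedComponentIn_eq hzb]
    exact isPreconnected_connectedComponentIn.subset_connectedComponentIn hza
      (subset_compl_singleton_iff.2 hy)
  have h2 : connectedComponentIn {y}ᶜ b ⊆ connectedComponentIn {x}ᶜ a := by
    rw [connectedComponentIn_eq hza]
    exact isPreconnected_connectedComponentIn.subset_connectedComponentIn hzb
      (subset_compl_singleton_iff.2 hx)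
  have hclosed : IsClosed (connectedComponentIn {x}ᶜ a) := by
    refine isClosed_of_closure_subset fun w hw => ?_
    rcases closure_connectedComponentIn_compl_singleton_subset x a hw with rfl | h
    · rcases closure_connectedComponentIn_compl_singleton_subset y b (closure_mono h1 hw) with h | h
      · exact (hxy h).elim
      · exact h2 h
    · exact h
  have huniv := IsClopen.eq_univ ⟨hclosed, isOpen_compl_singleton.connectedComponentIn⟩ ⟨z, hza⟩
  exact hy (huniv ▸ mem_univ y)

end Components

/-- In a dendrite, all but countably many points of an arc are cutpoints of order 2. -/
theorem Path.countable_not_isOrderTwoCutpoint {X : Type*} [MetricSpace X] [CompactSpace X]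
    [PreconnectedSpace X] [LocallyConnectedSpace X] {p q : X}
    (hX : ∀ s : Set X, IsEmpty (s ≃ₜ AddCircle (1 : ℝ))) {α : Path p q}
    (hα : Function.Injective α) :
    {t ∈ Ioo (0 : I) 1 | ¬ IsOrderTwoCutpoint (α t)}.Countable := by
  have hp : ∀ t ∈ Ioo (0 : I) 1, p ≠ α t := fun t ht h =>
    ht.1.ne (hα (α.source.trans h))
  have hq : ∀ t ∈ Ioo (0 : I) 1, q ≠ α t := fun t ht h =>
    ht.2.ne' (hα (α.target.trans h))
  have hbranch : ∀ t ∈ {t ∈ Ioo (0 : I) 1 | ¬ IsOrderTwoCutpoint (α t)}, ∃ y, y ≠ α t ∧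
      Disjoint (connectedComponentIn {α t}ᶜ y) (range α) := by
    rintro t ⟨ht, hnot⟩
    have hsep := target_notMem_connectedComponentIn hX hα t
    by_contra! hcon
    refine hnot ⟨connectedComponentIn {α t}ᶜ p, connectedComponentIn {α t}ᶜ q, fun h => ?_, ?_⟩
    · exact hsep (h ▸ mem_connectedComponentIn (hq t ht))
    ext Z
    constructor
    · rintro ⟨y, hy, rfl⟩
      obtain ⟨_, hzy, s, rfl⟩ := not_disjoint_iff.1 (hcon y hy)
      have hst : s ≠ t := fun h => connectedComponentIn_subset _ _ hzy (congrArg α h)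
      rw [connectedComponentIn_eq hzy]
      rcases hst.lt_or_gt with hst | hst
      · refine Or.inl (connectedComponentIn_eq ?_).symm
        refine (isPreconnected_Iio.image α α.continuous.continuousOn).subset_connectedComponentIn
          ⟨0, ht.1, α.source⟩ ?_ ⟨s, hst, rfl⟩
        rintro _ ⟨r, hr, rfl⟩ h
        exact (mem_Iio.1 hr).ne (hα h)
      · refine Or.inr (connectedComponentIn_eq ?_).symm
        refine (isPreconnected_Ioi.image α α.continuous.continuousOn).subset_connectedComponentIn
          ⟨1, ht.2, α.target⟩ ?_ ⟨s, hst, rfl⟩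
        rintro _ ⟨r, hr, rfl⟩ h
        exact (mem_Ioi.1 hr).ne' (hα h)
    · rintro (rfl | rfl)
      · exact ⟨p, hp t ht, rfl⟩
      · exact ⟨q, hq t ht, rfl⟩
  have : Nonempty X := ⟨p⟩
  choose! y hy hdis using hbranch
  refine PairwiseDisjoint.countable_of_isOpen (s := fun t => connectedComponentIn {α t}ᶜ (y t))
    (fun s hs t ht hst => ?_) (fun t _ => isOpen_compl_singleton.connectedComponentIn)
    fun t ht => ⟨y t, mem_connectedComponentIn (hy t ht)⟩
  exact disjoint_connectedComponentIn_compl_singleton (hα.ne hst)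
    (fun h => disjoint_left.1 (hdis s hs) h (mem_range_self t))
    fun h => disjoint_left.1 (hdis t ht) h (mem_range_self s)

/-- A nondegenerate dendrite (a compact connected locally connected metric
space with more than one point containing no subspace homeomorphic to the circle) has
uncountably many cutpoints of order 2; in particular, for every countable subset `U`
there is such a cutpoint outside `U`. -/
theorem dendrite_uncountably_many_order_two_cutpoints
    (A : Type*) [MetricSpace A] [CompactSpace A] [ConnectedSpace A]
    [LocallyConnectedSpace A] [Nontrivial A]
    (hnocircle : ∀ s : Set A, IsEmpty (s ≃ₜ AddCircle (1 : ℝ))) :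
    ¬ Set.Countable {x : A | IsOrderTwoCutpoint x} ∧
    ∀ U : Set A, U.Countable → ∃ x : A, x ∉ U ∧ IsOrderTwoCutpoint x := by
  have hunc : ¬ {x : A | IsOrderTwoCutpoint x}.Countable := by
    intro hcount
    have := locallyPathConnectedSpace_of_completeSpace (X := A)
    have := PathConnectedSpace.of_locallyPathConnectedSpace (X := A)
    obtain ⟨p, q, hpq⟩ := exists_pair_ne A
    obtain ⟨α, hα, -⟩ := (PathConnectedSpace.somePath p q).exists_injective hpq
    have h := (hcount.preimage hα).union (α.countable_not_isOrderTwoCutpoint hnocircle hα)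
    have hI : (Ioo (0 : I) 1).Countable := h.mono fun t ht =>
      (em (IsOrderTwoCutpoint (α t))).imp id fun h => ⟨ht, h⟩
    have hR : (Ioo (0 : ℝ) 1).Countable := by
      refine (hI.image Subtype.val).mono fun t ht => ?_
      exact ⟨⟨t, Ioo_subset_Icc_self ht⟩, ht, rfl⟩
    exact (Cardinal.Real.Ioo_countable_iff.1 hR).not_gt zero_lt_one
  refine ⟨hunc, fun U hU => ?_⟩
  by_contra! h
  exact hunc (hU.mono fun x hx => by_contra fun hxU => h x hxU hx)
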